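/- Hasse–Davenport relation: let q be a prime power, ψ_q = ψ_p ∘ Tr_{F_q/F_p} the standard additive character of F_q, and λ: F_q^* → C^* a multiplicative character. For the character φ = λ ∘ Norm_{F_{q^m}/F_q} of F_{q^m}^*, define Gauss sums τ(λ) = Σ_{x∈F_q^*} λ(x)ψ_q(x) and τ(φ) = Σ_{y∈F_{q^m}^*} φ(y)ψ_{q^m}(y). Then −τ(φ) = (−τ(λ))^m. -/

import Mathlib

/- STATEMENT 18: the Hasse–Davenport relation −τ(φ) = (−τ(λ))^m for the Gauss sums
   of λ : F_q^* → ℂ^* and its norm lift φ = λ ∘ N_{F_{q^m}/F_q}, with the standard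
   additive characters ψ_q = ψ_p ∘ Tr_{F_q/F_p}, ψ_{q^m} = ψ_p ∘ Tr_{F_{q^m}/F_p}. -/

attribute [local instance] Classical.propDecidable

/-- `ψ_p(z) = exp(2πi·z/p)` on `F_p = ZMod p`. -/
noncomputable def psip (p : ℕ) (z : ZMod p) : ℂ :=
  Complex.exp (2 * Real.pi * Complex.I * (z.val : ℂ) / p)

namespace HD
open Polynomial

theorem finite_monic (F : Type) [Field F] [Fintype F] (n : ℕ) :
    {f : F[X] | f.Monic ∧ f.natDegree = n}.Finite := by
  have e := (monicEquivDegreeLT (R := F) n).trans (degreeLTEquiv F n).toEquiv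
  have : Finite {f : F[X] // f.Monic ∧ f.natDegree = n} := Finite.of_equiv _ e.symm
  exact Set.finite_coe_iff.1 this

/-- Monic polynomials of degree `n`. -/
noncomputable def M (F : Type) [Field F] [Fintype F] (n : ℕ) : Finset F[X] :=
  (finite_monic F n).toFinset

theorem mem_M {F : Type} [Field F] [Fintype F] {n : ℕ} {f : F[X]} :
    f ∈ M F n ↔ f.Monic ∧ f.natDegree = n := by
  simp [M]

/-- Monic irreducibles of degree at most `N`. -/
noncomputable def S (F : Type) [Field F] [Fintype F] (N : ℕ) : Finset F[X] :=
  ((Finset.range (N + 1)).biUnion (M F)).filter Irreducible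

theorem mem_S {F : Type} [Field F] [Fintype F] {N : ℕ} {f : F[X]} :
    f ∈ S F N ↔ f.Monic ∧ f.natDegree ≤ N ∧ Irreducible f := by
  simp only [S, Finset.mem_filter, Finset.mem_biUnion, Finset.mem_range, mem_M]
  constructor
  · rintro ⟨⟨a, h1, h2, h3⟩, h4⟩
    exact ⟨h2, by omega, h4⟩
  · rintro ⟨h1, h2, h3⟩
    exact ⟨⟨_, by omega, h1, rfl⟩, h3⟩

theorem degree_eq_sum {F : Type} [Field F] [Fintype F] {N n : ℕ} (hn : n ≤ N) {f : F[X]}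
    (hf : f ∈ M F n) :
    n = ∑ P ∈ S F N, ∑ j ∈ Finset.Icc 1 N, if P ^ j ∣ f then P.natDegree else 0 := by
  obtain ⟨hm, hd⟩ := mem_M.1 hf
  have hf0 : f ≠ 0 := hm.ne_zero
  have hmon : ∀ P ∈ UniqueFactorizationMonoid.normalizedFactors f, P.Monic := by
    intro P hP
    have h0 : P ≠ 0 := (UniqueFactorizationMonoid.irreducible_of_normalized_factor P hP).ne_zero
    have h1 := UniqueFactorizationMonoid.normalize_normalized_factor P hP
    rw [← h1]
    exact Polynomial.monic_normalize h0
  have hprod : (UniqueFactorizationMonoid.normalizedFactors f).prod = f := by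
    rw [UniqueFactorizationMonoid.prod_normalizedFactors_eq hf0, hm.normalize_eq_self]
  have hsum : f.natDegree =
      ((UniqueFactorizationMonoid.normalizedFactors f).map natDegree).sum := by
    conv_lhs => rw [← hprod]
    exact natDegree_multiset_prod_of_monic _ hmon
  have hsub : (UniqueFactorizationMonoid.normalizedFactors f).toFinset ⊆ S F N := by
    intro P hP
    rw [Multiset.mem_toFinset] at hP
    refine mem_S.2 ⟨hmon P hP, ?_,
      UniqueFactorizationMonoid.irreducible_of_normalized_factor P hP⟩
    exact (natDegree_le_of_dvd (UniqueFactorizationMonoid.dvd_of_mem_normalizedFactors hP)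
      hf0).trans (hd.le.trans hn)
  rw [← hd, hsum, Finset.sum_multiset_map_count, Finset.sum_subset hsub]
  · refine Finset.sum_congr rfl fun P hP => ?_
    obtain ⟨hPm, hPd, hPi⟩ := mem_S.1 hP
    rw [← Finset.sum_filter, Finset.sum_const]
    congr 1
    have hiff : ∀ j : ℕ, P ^ j ∣ f ↔
        j ≤ (UniqueFactorizationMonoid.normalizedFactors f).count P := by
      intro j
      rw [pow_dvd_iff_le_emultiplicity,
        UniqueFactorizationMonoid.emultiplicity_eq_count_normalizedFactors hPi hf0,
        hPm.normalize_eq_self]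
      exact Nat.cast_le
    have hle : (UniqueFactorizationMonoid.normalizedFactors f).count P ≤ N := by
      have h1 := (hiff _).2 le_rfl
      have h2 := natDegree_le_of_dvd h1 hf0
      rw [natDegree_pow] at h2
      have h3 := hPi.natDegree_pos
      nlinarith
    have : (Finset.Icc 1 N).filter (fun j => P ^ j ∣ f) =
        Finset.Icc 1 ((UniqueFactorizationMonoid.normalizedFactors f).count P) := by
      ext j
      simp only [Finset.mem_filter, Finset.mem_Icc, hiff]
      omega
    rw [this]; simp
  · intro P _ hP
    rw [Multiset.mem_toFinset] at hP
    simp [Multiset.count_eq_zero_of_notMem hP]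

section rec
variable {F : Type} [Field F] [Fintype F] (χ : F[X] → ℂ)

noncomputable def a (n : ℕ) : ℂ := ∑ f ∈ M F n, χ f

noncomputable def s (N k : ℕ) : ℂ := ∑ P ∈ S F N, ∑ j ∈ Finset.Icc 1 N,
  if j * P.natDegree = k then (P.natDegree : ℂ) * χ P ^ j else 0

variable (h1 : χ 1 = 1) (hmul : ∀ f g : F[X], f.Monic → g.Monic → χ (f * g) = χ f * χ g)
include h1 hmul

omit [Fintype F] in
theorem chi_pow {P : F[X]} (hP : P.Monic) (j : ℕ) : χ (P ^ j) = χ P ^ j := by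
  induction j with
  | zero => simp [h1]
  | succ j ih => rw [pow_succ, hmul _ _ (hP.pow j) hP, ih, pow_succ]

theorem inner_sum {P : F[X]} (hP : P.Monic) (j n : ℕ) :
    ∑ f ∈ (M F n).filter (fun f => P ^ j ∣ f), χ f =
      if j * P.natDegree ≤ n then χ P ^ j * a χ (n - j * P.natDegree) else 0 := by
  split_ifs with h
  · rw [a, Finset.mul_sum]
    symm
    refine Finset.sum_bij (fun g _ => P ^ j * g) ?_ ?_ ?_ ?_
    · intro g hg
      obtain ⟨hg1, hg2⟩ := mem_M.1 hg
      refine Finset.mem_filter.2 ⟨mem_M.2 ⟨(hP.pow j).mul hg1, ?_⟩, dvd_mul_right _ _⟩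
      rw [(hP.pow j).natDegree_mul hg1, hP.natDegree_pow, hg2]
      omega
    · intro g _ g' _ h
      exact mul_left_cancel₀ (hP.pow j).ne_zero h
    · intro f hf
      obtain ⟨hf, g, rfl⟩ := Finset.mem_filter.1 hf
      obtain ⟨hf1, hf2⟩ := mem_M.1 hf
      have hg : g.Monic := (hP.pow j).of_mul_monic_left hf1
      refine ⟨g, mem_M.2 ⟨hg, ?_⟩, rfl⟩
      rw [(hP.pow j).natDegree_mul hg, hP.natDegree_pow] at hf2
      omega
    · intro g hg
      rw [hmul _ _ (hP.pow j) (mem_M.1 hg).1, chi_pow χ h1 hmul hP]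
  · refine Finset.sum_eq_zero fun f hf => ?_
    exfalso
    obtain ⟨hf, hd⟩ := Finset.mem_filter.1 hf
    obtain ⟨hf1, hf2⟩ := mem_M.1 hf
    have := natDegree_le_of_dvd hd hf1.ne_zero
    rw [hP.natDegree_pow] at this
    omega

theorem newton {n N : ℕ} (hn : n ≤ N) :
    (n : ℂ) * a χ n = ∑ k ∈ Finset.Icc 1 n, s χ N k * a χ (n - k) := by
  have e1 : (n : ℂ) * a χ n = ∑ P ∈ S F N, ∑ j ∈ Finset.Icc 1 N,
      (P.natDegree : ℂ) * ∑ f ∈ (M F n).filter (fun f => P ^ j ∣ f), χ f := by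
    rw [a, Finset.mul_sum]
    have : ∀ f ∈ M F n, (n : ℂ) * χ f = ∑ P ∈ S F N, ∑ j ∈ Finset.Icc 1 N,
        if P ^ j ∣ f then (P.natDegree : ℂ) * χ f else 0 := by
      intro f hf
      conv_lhs => rw [degree_eq_sum hn hf]
      push_cast
      simp only [Finset.sum_mul, ite_mul, zero_mul]
    rw [Finset.sum_congr rfl this, Finset.sum_comm]
    refine Finset.sum_congr rfl fun P _ => ?_
    rw [Finset.sum_comm]
    refine Finset.sum_congr rfl fun j _ => ?_
    rw [Finset.mul_sum, Finset.sum_filter]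
  rw [e1]
  simp only [s, Finset.sum_mul]
  conv_rhs => rw [Finset.sum_comm]
  refine Finset.sum_congr rfl fun P hP => ?_
  conv_rhs => rw [Finset.sum_comm]
  refine Finset.sum_congr rfl fun j hj => ?_
  obtain ⟨hPm, hPd, hPi⟩ := mem_S.1 hP
  rw [inner_sum χ h1 hmul hPm]
  simp only [ite_mul, zero_mul]
  rw [Finset.sum_ite_eq]
  have h3 := hPi.natDegree_pos
  have h4 := (Finset.mem_Icc.1 hj).1
  have h5 : 1 ≤ j * P.natDegree := Nat.mul_pos h4 h3
  simp only [Finset.mem_Icc, h5, true_and]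
  split_ifs <;> ring

theorem s_eq (h0 : a χ 0 = 1) (ha : ∀ n, 2 ≤ n → a χ n = 0) (N : ℕ) :
    ∀ n, 1 ≤ n → n ≤ N → - s χ N n = (- a χ 1) ^ n := by
  intro n hn
  induction n, hn using Nat.le_induction with
  | base =>
    intro h
    have := newton χ h1 hmul h
    simp [h0] at this
    simp [this]
  | succ n hn ih =>
    intro h
    have e := newton χ h1 hmul h
    rw [ha _ (by omega), Finset.sum_Icc_succ_top (by omega)] at e
    have : ∑ k ∈ Finset.Icc 1 n, s χ N k * a χ (n + 1 - k) = s χ N n * a χ 1 := by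
      rw [Finset.sum_eq_single n]
      · simp
      · intro k hk hkn
        rw [Finset.mem_Icc] at hk
        rw [ha _ (by omega), mul_zero]
      · intro h; simp at h; omega
    rw [this] at e
    simp [h0] at e
    rw [pow_succ, ← ih (by omega)]
    linear_combination e
end rec

section chi
variable {F : Type} [Field F] [Fintype F] (μ : MulChar F ℂ) (Ψ : AddChar F ℂ)

omit [Fintype F] in
/-- The multiplicative function on monic polynomials. -/
noncomputable def chi (f : F[X]) : ℂ := μ ((-1) ^ f.natDegree * f.coeff 0) * Ψ (-f.nextCoeff)

omit [Fintype F] in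
theorem chi_one : chi μ Ψ 1 = 1 := by
  simp [chi, nextCoeff]

omit [Fintype F] in
theorem chi_mul (f g : F[X]) (hf : f.Monic) (hg : g.Monic) :
    chi μ Ψ (f * g) = chi μ Ψ f * chi μ Ψ g := by
  unfold chi
  rw [hf.natDegree_mul hg, hf.nextCoeff_mul hg, mul_coeff_zero, pow_add, neg_add,
    AddChar.map_add_eq_mul]
  simp only [map_mul]
  ring

theorem a_zero : a (chi μ Ψ) 0 = 1 := by
  have : M F 0 = {1} := by
    ext f
    rw [mem_M, Finset.mem_singleton]
    constructor
    · rintro ⟨h, h'⟩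
      exact eq_one_of_monic_natDegree_zero h h'
    · rintro rfl; simp
  rw [a, this, Finset.sum_singleton, chi_one]

theorem a_one : a (chi μ Ψ) 1 = ∑ x : F, μ x * Ψ x := by
  rw [a]
  symm
  refine Finset.sum_bij (fun x _ => X - C x) ?_ ?_ ?_ ?_
  · intro x _
    exact mem_M.2 ⟨monic_X_sub_C x, natDegree_X_sub_C x⟩
  · intro x _ y _ h
    simpa using h
  · intro f hf
    obtain ⟨h, h'⟩ := mem_M.1 hf
    refine ⟨-f.coeff 0, Finset.mem_univ _, ?_⟩
    rw [h.eq_X_add_C h']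
    simp
  · intro x _
    simp [chi]

theorem a_ge (hΨ : Ψ ≠ 1) (n : ℕ) (hn : 2 ≤ n) : a (chi μ Ψ) n = 0 := by
  obtain ⟨t, ht⟩ : ∃ t, Ψ t ≠ 1 := by
    by_contra h
    push Not at h
    exact hΨ (by ext x; simp [h x])
  have key : ∀ (t : F) (f : F[X]), f ∈ M F n →
      f + C t * X ^ (n - 1) ∈ M F n ∧
      chi μ Ψ (f + C t * X ^ (n - 1)) = Ψ (-t) * chi μ Ψ f := by
    intro t f hf
    obtain ⟨h, h'⟩ := mem_M.1 hf
    have hdeg : (C t * X ^ (n - 1)).degree < f.degree := by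
      rw [degree_eq_natDegree h.ne_zero, h']
      refine (degree_C_mul_X_pow_le _ _).trans_lt ?_
      exact_mod_cast (by omega : n - 1 < n)
    have hd : (f + C t * X ^ (n - 1)).natDegree = n := by
      rw [natDegree_eq_of_degree_eq (degree_add_eq_left_of_degree_lt hdeg), h']
    refine ⟨mem_M.2 ⟨h.add_of_left hdeg, hd⟩, ?_⟩
    unfold chi
    rw [nextCoeff_of_natDegree_pos (by omega), nextCoeff_of_natDegree_pos (by omega), hd, h']
    simp only [coeff_add, coeff_C_mul, coeff_X_pow, neg_add, AddChar.map_add_eq_mul]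
    rw [if_neg (by omega)]
    simp
    ring
  have e : a (chi μ Ψ) n = Ψ t * a (chi μ Ψ) n := by
    unfold a
    rw [Finset.mul_sum]
    symm
    refine Finset.sum_bij (fun f _ => f + C (-t) * X ^ (n - 1)) ?_ ?_ ?_ ?_
    · intro f hf; exact (key _ f hf).1
    · intro f _ g _ h; simpa using h
    · intro f hf
      exact ⟨f + C t * X ^ (n - 1), (key _ f hf).1, by simp⟩
    · intro f hf
      rw [(key _ f hf).2, neg_neg]
  have : (1 - Ψ t) * a (chi μ Ψ) n = 0 := by linear_combination e
  rcases mul_eq_zero.1 this with h | h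
  · exact absurd (sub_eq_zero.1 h).symm ht
  · exact h

theorem card_fiber {K : Type} [Field K] [Fintype K] [Algebra F K] {P : F[X]} (hP : P.Monic)
    (hi : Irreducible P) :
    (Finset.univ.filter (fun y : K => minpoly F y = P)).card =
      if P.natDegree ∣ Module.finrank F K then P.natDegree else 0 := by
  split_ifs with h
  · have hs : (P.map (algebraMap F K)).Splits := by
      have : Fact (Irreducible P) := ⟨hi⟩
      have pb := AdjoinRoot.powerBasis hi.ne_zero
      have : Module.Finite F (AdjoinRoot P) := pb.finite
      have hfr : Module.finrank F (AdjoinRoot P) = P.natDegree := by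
        rw [(AdjoinRoot.powerBasis hi.ne_zero).finrank, AdjoinRoot.powerBasis_dim]
      have : Finite (AdjoinRoot P) := Module.finite_of_finite F
      obtain ⟨g⟩ := FiniteField.nonempty_algHom_of_finrank_dvd (F := F) (K := AdjoinRoot P)
        (L := K) (hfr ▸ h)
      have hroot : aeval (g (AdjoinRoot.root P)) P = 0 := by
        rw [aeval_algHom_apply, AdjoinRoot.aeval_eq, AdjoinRoot.mk_self, map_zero]
      rw [minpoly.eq_of_irreducible_of_monic hi hroot hP]
      exact Normal.splits inferInstance _
    have hsep : P.Separable := PerfectField.separable_of_irreducible hi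
    rw [← card_rootSet_eq_natDegree hsep hs, ← Set.toFinset_card]
    congr 1
    ext y
    simp only [Finset.mem_filter, Finset.mem_univ, true_and, Set.mem_toFinset]
    rw [mem_rootSet]
    constructor
    · rintro rfl
      exact ⟨hP.ne_zero, minpoly.aeval _ _⟩
    · rintro ⟨_, h⟩
      exact (minpoly.eq_of_irreducible_of_monic hi h hP).symm
  · rw [Finset.card_eq_zero, Finset.filter_eq_empty_iff]
    rintro y _ rfl
    exact h (minpoly.degree_dvd (.of_finite F y))

omit [Fintype F] in
theorem chi_minpoly {K : Type} [Field K] [Fintype K] [Algebra F K] (y : K) :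
    μ (Algebra.norm F y) * Ψ (Algebra.trace F K y) =
      chi μ Ψ (minpoly F y) ^ (Module.finrank F K / (minpoly F y).natDegree) := by
  have hy : IsIntegral F y := .of_finite F y
  have hfin : Module.finrank F K / (minpoly F y).natDegree =
      Module.finrank (IntermediateField.adjoin F {y}) K := by
    rw [← IntermediateField.adjoin.finrank hy, ← Module.finrank_mul_finrank F
      (IntermediateField.adjoin F {y}) K]
    exact Nat.mul_div_cancel_left _ Module.finrank_pos
  have hn := Algebra.PowerBasis.norm_gen_eq_coeff_zero_minpoly
    (IntermediateField.adjoin.powerBasis hy)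
  rw [hfin, Algebra.norm_eq_norm_adjoin, trace_eq_trace_adjoin, trace_adjoinSimpleGen hy]
  rw [IntermediateField.adjoin.powerBasis_gen, IntermediateField.minpoly_gen,
    IntermediateField.adjoin.powerBasis_dim] at hn
  rw [hn, chi, map_pow, AddChar.map_nsmul_eq_pow, mul_pow]

theorem s_top {K : Type} [Field K] [Fintype K] [Algebra F K] :
    s (chi μ Ψ) (Module.finrank F K) (Module.finrank F K) =
      ∑ y : K, μ (Algebra.norm F y) * Ψ (Algebra.trace F K y) := by
  have hm : 0 < Module.finrank F K := Module.finrank_pos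
  have hmaps : ∀ y ∈ (Finset.univ : Finset K), minpoly F y ∈ S F (Module.finrank F K) := by
    intro y _
    have hy : IsIntegral F y := .of_finite F y
    exact mem_S.2 ⟨minpoly.monic hy, Nat.le_of_dvd hm (minpoly.degree_dvd (.of_finite F y)),
      minpoly.irreducible hy⟩
  rw [← Finset.sum_fiberwise_of_maps_to hmaps, s]
  refine Finset.sum_congr rfl fun P hP => ?_
  obtain ⟨hPm, hPd, hPi⟩ := mem_S.1 hP
  have hpos := hPi.natDegree_pos
  have : ∀ y ∈ Finset.univ.filter (fun y : K => minpoly F y = P),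
      μ (Algebra.norm F y) * Ψ (Algebra.trace F K y) =
        chi μ Ψ P ^ (Module.finrank F K / P.natDegree) := by
    intro y hy
    rw [chi_minpoly, (Finset.mem_filter.1 hy).2]
  rw [Finset.sum_congr rfl this, Finset.sum_const, card_fiber hPm hPi]
  split_ifs with h
  · obtain ⟨c, hc⟩ := h
    have hc0 : 0 < c := by
      rcases Nat.eq_zero_or_pos c with rfl | h
      · omega
      · exact h
    rw [hc, Nat.mul_div_cancel_left _ hpos, Finset.sum_eq_single c]
    · rw [if_pos (mul_comm _ _), nsmul_eq_mul]
    · intro j _ hj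
      rw [if_neg]
      intro h
      rw [mul_comm] at h
      exact hj (Nat.eq_of_mul_eq_mul_left hpos h)
    · intro h
      exfalso
      apply h
      rw [Finset.mem_Icc]
      exact ⟨hc0, Nat.le_mul_of_pos_left _ hpos⟩
  · rw [zero_smul]
    refine Finset.sum_eq_zero fun j _ => ?_
    rw [if_neg]
    intro hj
    exact h ⟨j, by rw [← hj, mul_comm]⟩

theorem hasse_davenport {K : Type} [Field K] [Fintype K] [Algebra F K] (hΨ : Ψ ≠ 1) :
    -(∑ y : K, μ (Algebra.norm F y) * Ψ (Algebra.trace F K y)) =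
      (-(∑ x : F, μ x * Ψ x)) ^ Module.finrank F K := by
  rw [← s_top, ← a_one]
  exact s_eq _ (chi_one μ Ψ) (chi_mul μ Ψ) (a_zero μ Ψ) (a_ge μ Ψ hΨ) _ _ Module.finrank_pos le_rfl

end chi

theorem sum_units {G : Type} [Field G] [Fintype G] (f : G → ℂ) (hf : f 0 = 0) :
    ∑ y : Gˣ, f y = ∑ y : G, f y := by
  refine Finset.sum_of_injOn (fun y : Gˣ => (y : G)) (Units.val_injective.injOn) (by simp) ?_ (by simp)
  intro y _ hy
  by_cases h : y = 0
  · rw [h, hf]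
  · exact absurd ⟨Units.mk0 y h, by simp⟩ hy

end HD

theorem stmt18 (p : ℕ) [Fact p.Prime]
    (F K : Type) [Field F] [Fintype F] [Field K] [Fintype K]
    [Algebra (ZMod p) F] [Algebra (ZMod p) K] [Algebra F K] [IsScalarTower (ZMod p) F K]
    (lam : Fˣ →* ℂˣ) :
    -- −τ(φ) = (−τ(λ))^m, where m = [F_{q^m} : F_q],
    -- τ(λ) = Σ_{x∈F_q^*} λ(x)·ψ_q(x) and τ(φ) = Σ_{y∈F_{q^m}^*} λ(N(y))·ψ_{q^m}(y):
    -(∑ y : Kˣ, ((lam (Units.map (Algebra.norm F : K →* F) y) : ℂ) *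
        psip p (Algebra.trace (ZMod p) K (y : K))))
      = (-(∑ x : Fˣ, ((lam x : ℂ) * psip p (Algebra.trace (ZMod p) F (x : F)))))
          ^ (Module.finrank F K) := by
  have hF : Finite F := inferInstance
  let Ψ : AddChar F ℂ := (ZMod.stdAddChar (N := p)).compAddMonoidHom
    (Algebra.trace (ZMod p) F).toAddMonoidHom
  have hpsi : ∀ z : ZMod p, psip p z = ZMod.stdAddChar z := by
    intro z
    rw [ZMod.stdAddChar_apply, ZMod.toCircle_apply, psip]
  have hΨ : Ψ ≠ 1 := by
    intro h
    obtain ⟨x, hx⟩ := Algebra.trace_surjective (ZMod p) F 1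
    have h1 : Ψ x = 1 := by rw [h]; rfl
    have h2 : Ψ x = ZMod.stdAddChar (1 : ZMod p) := by rw [← hx]; rfl
    rw [h2, ← (ZMod.stdAddChar (N := p)).map_zero_eq_one, ZMod.injective_stdAddChar.eq_iff] at h1
    exact one_ne_zero h1
  have main := HD.hasse_davenport (K := K) (MulChar.ofUnitHom lam) Ψ hΨ
  have h0 : MulChar.ofUnitHom lam (0 : F) = 0 := MulChar.map_nonunit _ not_isUnit_zero
  rw [← HD.sum_units (G := K) (fun y => MulChar.ofUnitHom lam (Algebra.norm F y) *
      Ψ (Algebra.trace F K y)) (by rw [Algebra.norm_zero, h0, zero_mul]),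
    ← HD.sum_units (G := F) (fun x => MulChar.ofUnitHom lam x * Ψ x)
      (by rw [h0, zero_mul])] at main
  convert main using 3
  · rw [hpsi, ← Algebra.trace_trace (S := F), ← MulChar.ofUnitHom_coe]
    rfl
  · refine Finset.sum_congr rfl fun x _ => ?_
    rw [hpsi, ← MulChar.ofUnitHom_coe]
    rfl
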